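/- arXiv:2405.20945 — 2 statements merged into one kernel-verified Lean document; each statement's English description precedes it below -/
import Mathlib

section
/- Let S be a finite list of cyclically reduced words that is balanced, and let τ be a Whitehead substitution of type (2) with multiplier a. Let S′ be the list obtained by applying τ to every entry of S and then replacing every entry by its cyclic reduction. Then (algebraic length of S′) − (algebraic length of S) = 2·((total number of occurrences of the letter a among the entries of S′) − (total number of occurrences of the letter a among the entries of S)). -/
/-- A letter `x_i^{±1}`: the index `i` together with a sign (`true` for `x_i`,
`false` for `x_i⁻¹`). -/
abbrev Letter (g : ℕ) := Fin g × Bool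

/-- A word in the letters `x_1^{±1}, …, x_g^{±1}`. -/
abbrev Word (g : ℕ) := List (Letter g)

/-- The inverse of a letter. -/
def invL {g : ℕ} (a : Letter g) : Letter g := (a.1, !a.2)

/-- The inverse of a word: the reversed sequence with each letter inverted. -/
def wordInv {g : ℕ} (w : Word g) : Word g := (w.map invL).reverse

/-- Cancel the first adjacent pair of mutually inverse letters, if any. -/
def reduceOnce {g : ℕ} : Word g → Option (Word g)
  | [] => none
  | [_] => none
  | a :: b :: rest =>
    if b = invL a then some rest
    else (reduceOnce (b :: rest)).map (a :: ·)

/-- Perform one cyclic cancellation: cancel an adjacent pair of mutually inverse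
letters or, failing that, cancel the first and last letters if they are
mutually inverse. -/
def cycOnce {g : ℕ} (w : Word g) : Option (Word g) :=
  match reduceOnce w with
  | some w' => some w'
  | none =>
    match w with
    | [] => none
    | a :: t =>
      match t.getLast? with
      | none => none
      | some b => if a = invL b then some t.dropLast else none

/-- Auxiliary fuelled iteration of `cycOnce`; since every cancellation strictly
decreases the length, fuel `w.length` always suffices to reach a cyclically
reduced word. -/
def cyclicReduceAux {g : ℕ} : ℕ → Word g → Word g
  | 0, w => w
  | n + 1, w =>
    match cycOnce w with
    | none => w
    | some w' => cyclicReduceAux n w'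

/-- The cyclic reduction of a word, obtained by repeatedly cancelling adjacent
(or wrapping-around) pairs of mutually inverse letters. -/
def cyclicReduce {g : ℕ} (w : Word g) : Word g := cyclicReduceAux w.length w

/-- A word is cyclically reduced if no two consecutive letters, and also not the
last and first letters, are mutually inverse. -/
def IsCyclicallyReduced {g : ℕ} (w : Word g) : Prop :=
  w.Chain' (fun a b => b ≠ invL a) ∧ ∀ a ∈ w.head?, ∀ b ∈ w.getLast?, a ≠ invL b

/-- Total number of occurrences of the letter `a` among the entries of `S`. -/
def countS {g : ℕ} (S : List (Word g)) (a : Letter g) : ℕ :=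
  (S.map (fun w => w.count a)).sum

/-- Condition (A): for every `i`, the letters `x_i, x_i⁻¹` either do not occur
at all among the entries of `S`, or each occurs exactly once in total. -/
def CondA {g : ℕ} (S : List (Word g)) : Prop :=
  ∀ i : Fin g,
    (countS S (i, true) = 0 ∧ countS S (i, false) = 0) ∨
    (countS S (i, true) = 1 ∧ countS S (i, false) = 1)

/-- `S` is balanced: for every `i`, `x_i` and `x_i⁻¹` occur the same total
number of times among the entries of `S`. -/
def IsBalanced {g : ℕ} (S : List (Word g)) : Prop :=
  ∀ i : Fin g, countS S (i, true) = countS S (i, false)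

/-- A Whitehead substitution of type (1): a bijection of the set of letters
commuting with inversion. -/
def IsType1 {g : ℕ} (η : Letter g → Word g) : Prop :=
  ∃ π : Equiv.Perm (Letter g),
    (∀ a, π (invL a) = invL (π a)) ∧ ∀ a, η a = [π a]

/-- A Whitehead substitution of type (2) with multiplier `a`: it fixes `a` and
`a⁻¹`, and replaces every other generator `x_i` by one of `x_i`, `x_i a`,
`a⁻¹ x_i`, `a⁻¹ x_i a` (and `x_i⁻¹` by the inverse of the word substituted
for `x_i`). -/
def IsType2With {g : ℕ} (a : Letter g) (η : Letter g → Word g) : Prop :=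
  η a = [a] ∧ η (invL a) = [invL a] ∧
  ∀ i : Fin g, i ≠ a.1 →
    (η (i, true) = [(i, true)] ∨ η (i, true) = [(i, true), a] ∨
     η (i, true) = [invL a, (i, true)] ∨ η (i, true) = [invL a, (i, true), a]) ∧
    η (i, false) = wordInv (η (i, true))

/-- A Whitehead substitution of type (2). -/
def IsType2 {g : ℕ} (η : Letter g → Word g) : Prop := ∃ a, IsType2With a η

/-- A Whitehead substitution. -/
def IsWhitehead {g : ℕ} (η : Letter g → Word g) : Prop := IsType1 η ∨ IsType2 η

/-- Apply a substitution to a word, replacing each letter by the word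
substituted for it. -/
def applySub {g : ℕ} (η : Letter g → Word g) (w : Word g) : Word g :=
  (w.map η).flatten

/-- The algebraic length of a word: the number of letters of its cyclic
reduction. -/
def algLen {g : ℕ} (w : Word g) : ℕ := (cyclicReduce w).length

/-- The algebraic length of a finite list of words: the sum of the algebraic
lengths of its entries. -/
def algLenS {g : ℕ} (S : List (Word g)) : ℕ := (S.map algLen).sum

namespace WhiteheadAux

variable {g : ℕ}

/-- Exponent of a letter with respect to the multiplier. -/
def sg (a z : Letter g) : ℤ := if z = a then 1 else if z = invL a then -1 else 0

/-- Exponent sum of a word with respect to the multiplier. -/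
def es (a : Letter g) (w : Word g) : ℤ := (w.map (sg a)).sum

/-- Letters other than the multiplier, together with their heights. -/
def ht (a : Letter g) : ℤ → Word g → List (Letter g × ℤ)
  | _, [] => []
  | h, z :: w => if z.1 = a.1 then ht a (h + sg a z) w else (z, h) :: ht a h w

/-- Two consecutive entries do not cancel. -/
def nc (p q : Letter g × ℤ) : Prop := ¬ (q.1 = invL p.1 ∧ q.2 = p.2)

/-- The invariant. -/
def Good (a : Letter g) (w : Word g) : Prop := (ht a 0 (w ++ w)).IsChain nc

/-- Number of letters different from the multiplier and its inverse. -/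
def na (a : Letter g) (w : Word g) : ℕ := (ht a 0 w).length

theorem invL_invL (a : Letter g) : invL (invL a) = a := by simp [invL]

theorem invL_fst (a : Letter g) : (invL a).1 = a.1 := rfl

theorem invL_ne (a : Letter g) : invL a ≠ a := by
  intro h
  have := congrArg Prod.snd h
  simp [invL] at this

theorem fst_eq_iff (a z : Letter g) : z.1 = a.1 ↔ z = a ∨ z = invL a := by
  obtain ⟨i, b⟩ := z
  obtain ⟨j, c⟩ := a
  cases b <;> cases c <;> simp [invL]

theorem sg_self (a : Letter g) : sg a a = 1 := by simp [sg]

theorem sg_inv_self (a : Letter g) : sg a (invL a) = -1 := by simp [sg, invL_ne]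

theorem sg_of_ne (a z : Letter g) (h : z.1 ≠ a.1) : sg a z = 0 := by
  rw [Ne, fst_eq_iff, not_or] at h
  simp [sg, h]

theorem sg_invL (a z : Letter g) : sg a (invL z) = - sg a z := by
  by_cases h : z.1 = a.1
  · rcases (fst_eq_iff a z).1 h with rfl | rfl
    · simp [sg_self, sg_inv_self]
    · simp [sg_self, sg_inv_self, invL_invL]
  · rw [sg_of_ne a z h, sg_of_ne a (invL z) h]; rfl

theorem es_append (a : Letter g) (u v : Word g) : es a (u ++ v) = es a u + es a v := by
  simp [es]

theorem es_cons (a z : Letter g) (v : Word g) : es a (z :: v) = sg a z + es a v := by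
  simp [es]

theorem es_nil (a : Letter g) : es a [] = 0 := rfl

theorem ht_append (a : Letter g) (h : ℤ) (u v : Word g) :
    ht a h (u ++ v) = ht a h u ++ ht a (h + es a u) v := by
  induction u generalizing h with
  | nil => simp [ht, es]
  | cons z u ih =>
    simp only [List.cons_append, ht, es_cons]
    split_ifs with hz
    · rw [ih, add_assoc]
    · rw [ih, sg_of_ne a z hz]; simp

theorem ht_length (a : Letter g) (h h' : ℤ) (u : Word g) :
    (ht a h u).length = (ht a h' u).length := by
  induction u generalizing h h' with
  | nil => rfl
  | cons z u ih =>
    simp only [ht]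
    split_ifs
    · apply ih
    · simp [ih h h']

theorem na_append (a : Letter g) (u v : Word g) : na a (u ++ v) = na a u + na a v := by
  simp [na, ht_append, ht_length a (es a u) 0]

theorem ht_shift (a : Letter g) (h k : ℤ) (u : Word g) :
    ht a (h + k) u = (ht a h u).map (fun p => (p.1, p.2 + k)) := by
  induction u generalizing h with
  | nil => rfl
  | cons z u ih =>
    simp only [ht]
    split_ifs
    · rw [← ih]; congr 1; ring
    · simp [ih]

theorem chain_shift (a : Letter g) (h k : ℤ) (u : Word g) (hc : (ht a h u).IsChain nc) :
    (ht a k u).IsChain nc := by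
  have : k = h + (k - h) := by ring
  rw [this, ht_shift, List.isChain_map]
  refine hc.imp ?_
  intro p q
  simp [nc]

theorem ht_all (a : Letter g) (h : ℤ) (u : Word g) (hu : ∀ z ∈ u, z.1 = a.1) : ht a h u = [] := by
  induction u generalizing h with
  | nil => rfl
  | cons z u ih =>
    simp only [ht]
    rw [if_pos (hu z (by simp))]
    exact ih _ (fun y hy => hu y (by simp [hy]))

theorem length_eq (a : Letter g) (w : Word g) :
    (w.length : ℤ) = 2 * (w.count a : ℤ) - es a w + na a w := by
  induction w with
  | nil => simp [es, na, ht]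
  | cons z w ih =>
    have hna : na a (z :: w) = na a [z] + na a w := na_append a [z] w
    rw [hna, es_cons, List.count_cons]
    push_cast
    simp only [List.length_cons]
    push_cast
    rw [ih]
    by_cases h : z.1 = a.1
    · have h0 : na a [z] = 0 := by simp [na, ht, h]
      rcases (fst_eq_iff a z).1 h with rfl | rfl
      · simp [sg_self, h0]; ring
      · simp [sg_inv_self, h0, invL_ne]; ring
    · have h0 : na a [z] = 1 := by simp [na, ht, h]
      have : z ≠ a := by rintro rfl; exact h rfl
      simp [sg_of_ne a z h, h0, this]; ring

/-! ### Reduced words satisfy the invariant -/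

theorem chain_red_aux (a : Letter g) (w : Word g) : ∀ (x l : Letter g) (hp h : ℤ),
    x.1 ≠ a.1 → (l :: w).IsChain (fun a b => b ≠ invL a) →
    ((l = x ∧ h = hp) ∨ (l = a ∧ hp < h) ∨ (l = invL a ∧ h < hp)) →
    ((x, hp) :: ht a h w).IsChain nc := by
  induction w with
  | nil => intros; simp [ht]
  | cons z w ih =>
    intro x l hp h hx hc hl
    rw [List.isChain_cons_cons] at hc
    obtain ⟨hz, hc⟩ := hc
    simp only [ht]
    split_ifs with hza
    · apply ih x z hp _ hx hc
      rcases (fst_eq_iff a z).1 hza with rfl | rfl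
      · right; left
        refine ⟨rfl, ?_⟩
        rw [sg_self]
        rcases hl with ⟨_, h1⟩ | ⟨_, h1⟩ | ⟨h2, h1⟩
        · omega
        · omega
        · exact absurd (by rw [h2, invL_invL]) hz
      · right; right
        refine ⟨rfl, ?_⟩
        rw [sg_inv_self]
        rcases hl with ⟨_, h1⟩ | ⟨h2, h1⟩ | ⟨_, h1⟩
        · omega
        · exact absurd (by rw [h2]) hz
        · omega
    · rw [List.isChain_cons_cons]
      refine ⟨?_, ih z z h h hza hc (Or.inl ⟨rfl, rfl⟩)⟩
      rintro ⟨h1, h2⟩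
      simp only at h1 h2
      rcases hl with ⟨h3, _⟩ | ⟨_, h3⟩ | ⟨_, h3⟩
      · exact hz (by rw [h3, h1])
      · omega
      · omega

theorem chain_red (a : Letter g) (w : Word g) (h : ℤ)
    (hc : w.IsChain (fun a b => b ≠ invL a)) : (ht a h w).IsChain nc := by
  induction w generalizing h with
  | nil => simp [ht]
  | cons z w ih =>
    simp only [ht]
    split_ifs with hza
    · exact ih _ hc.tail
    · exact chain_red_aux a w z z h h hza hc (Or.inl ⟨rfl, rfl⟩)

theorem good_of_cyc (a : Letter g) (w : Word g) (hw : IsCyclicallyReduced w) : Good a w := by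
  apply chain_red
  obtain ⟨h1, h2⟩ := hw
  refine List.IsChain.append h1 h1 ?_
  intro x hx y hy
  exact h2 y hy x hx

/-! ### Substitutions preserve the invariant -/

/-- Abstract form of the substitution. -/
def Sub (a : Letter g) (η : Letter g → Word g) (d : Letter g → ℤ) : Prop :=
  (∀ z, z.1 = a.1 → η z = [z]) ∧
  ∀ l, l.1 ≠ a.1 → ∃ P Q : Word g, (∀ z ∈ P, z.1 = a.1) ∧ (∀ z ∈ Q, z.1 = a.1) ∧
    η l = P ++ l :: Q ∧ es a P = - d l ∧ es a Q = d (invL l)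

theorem exists_sub (a : Letter g) (η : Letter g → Word g) (hη : IsType2With a η) :
    ∃ d, Sub a η d := by
  obtain ⟨h1, h2, h3⟩ := hη
  refine ⟨fun l => if (η l).head? = some (invL a) then 1 else 0, ?_, ?_⟩
  · intro z hz
    rcases (fst_eq_iff a z).1 hz with rfl | rfl <;> assumption
  · rintro ⟨i, b⟩ hi
    have hi : i ≠ a.1 := hi
    obtain ⟨h4, h5⟩ := h3 i hi
    have e1 : ∀ b, (i, b) ≠ invL a := fun b h => hi (congrArg Prod.fst h)
    have e2 : invL (i, true) = (i, false) := rfl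
    have e3 : invL (i, false) = (i, true) := rfl
    have e4 : ∀ b, (i, b) ≠ a := fun b h => hi (congrArg Prod.fst h)
    rcases h4 with h4 | h4 | h4 | h4 <;> rw [h4] at h5 <;>
      simp [wordInv, invL_invL, e2] at h5 <;> cases b
    · exact ⟨[], [], by simp [h4, h5, e1, e2, e3, es_nil]⟩
    · exact ⟨[], [], by simp [h4, h5, e1, e2, e3, es_nil]⟩
    · exact ⟨[invL a], [], by simp [h4, h5, e1, e2, e3, es_nil, es_cons, sg_inv_self, invL_fst]⟩
    · exact ⟨[], [a], by simp [h4, h5, e1, e2, e3, es_nil, es_cons, sg_self]⟩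
    · exact ⟨[], [a], by simp [h4, h5, e1, e2, e3, es_nil, es_cons, sg_self]⟩
    · exact ⟨[invL a], [], by simp [h4, h5, e1, e2, e3, es_nil, es_cons, sg_inv_self, invL_fst]⟩
    · exact ⟨[invL a], [a], by
        simp [h4, h5, e1, e2, e3, es_nil, es_cons, sg_inv_self, sg_self, invL_fst]⟩
    · exact ⟨[invL a], [a], by
        simp [h4, h5, e1, e2, e3, es_nil, es_cons, sg_inv_self, sg_self, invL_fst]⟩

theorem applySub_cons (η : Letter g → Word g) (z : Letter g) (w : Word g) :
    applySub η (z :: w) = η z ++ applySub η w := by simp [applySub]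

theorem applySub_append (η : Letter g → Word g) (v w : Word g) :
    applySub η (v ++ w) = applySub η v ++ applySub η w := by simp [applySub]

theorem ht_sub_cons (a : Letter g) (η : Letter g → Word g) (d : Letter g → ℤ) (hs : Sub a η d)
    (z : Letter g) (hz : z.1 ≠ a.1) (w : Word g) (h : ℤ) :
    ht a h (applySub η (z :: w)) =
      (z, h - d z) :: ht a (h - d z + d (invL z)) (applySub η w) := by
  obtain ⟨P, Q, hP, hQ, e, eP, eQ⟩ := hs.2 z hz
  rw [applySub_cons, e, List.append_assoc, ht_append, ht_all a h P hP, eP, List.nil_append,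
    List.cons_append]
  simp only [ht, if_neg hz]
  rw [ht_append, ht_all a _ Q hQ, eQ, List.nil_append]
  rfl

theorem ht_sub_cons' (a : Letter g) (η : Letter g → Word g) (d : Letter g → ℤ) (hs : Sub a η d)
    (z : Letter g) (hz : z.1 = a.1) (w : Word g) (h : ℤ) :
    ht a h (applySub η (z :: w)) = ht a (h + sg a z) (applySub η w) := by
  rw [applySub_cons, hs.1 z hz]
  simp [ht, hz]

theorem na_sub (a : Letter g) (η : Letter g → Word g) (d : Letter g → ℤ) (hs : Sub a η d)
    (w : Word g) : na a (applySub η w) = na a w := by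
  unfold na
  induction w with
  | nil => rfl
  | cons z w ih =>
    by_cases hz : z.1 = a.1
    · rw [ht_sub_cons' a η d hs z hz, ht_length a _ 0, ih]
      simp only [ht, if_pos hz]
      apply ht_length
    · rw [ht_sub_cons a η d hs z hz, List.length_cons, ht_length a _ 0, ih]
      simp [ht, if_neg hz]

theorem chain_sub_aux (a : Letter g) (η : Letter g → Word g) (d : Letter g → ℤ) (hs : Sub a η d)
    (w : Word g) : ∀ (x : Letter g) (hp h hp' h' : ℤ),
    ((x, hp) :: ht a h w).IsChain nc → h' - hp' = h - hp + d (invL x) →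
    ((x, hp') :: ht a h' (applySub η w)).IsChain nc := by
  induction w with
  | nil => intros; simp [ht, applySub]
  | cons z w ih =>
    intro x hp h hp' h' hc e
    by_cases hz : z.1 = a.1
    · rw [ht_sub_cons' a η d hs z hz]
      simp only [ht, if_pos hz] at hc
      exact ih x hp _ hp' _ hc (by omega)
    · rw [ht_sub_cons a η d hs z hz]
      simp only [ht, if_neg hz] at hc
      rw [List.isChain_cons_cons] at hc ⊢
      refine ⟨?_, ih z h h _ _ hc.2 (by omega)⟩
      rintro ⟨h1, h2⟩
      apply hc.1
      simp only at h1 h2 ⊢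
      refine ⟨h1, ?_⟩
      rw [← h1] at e
      omega

theorem chain_sub (a : Letter g) (η : Letter g → Word g) (d : Letter g → ℤ) (hs : Sub a η d)
    (w : Word g) (h h' : ℤ) (hc : (ht a h w).IsChain nc) :
    (ht a h' (applySub η w)).IsChain nc := by
  induction w generalizing h h' with
  | nil => simp [ht, applySub]
  | cons z w ih =>
    by_cases hz : z.1 = a.1
    · rw [ht_sub_cons' a η d hs z hz]
      simp only [ht, if_pos hz] at hc
      exact ih _ _ hc
    · rw [ht_sub_cons a η d hs z hz]
      simp only [ht, if_neg hz] at hc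
      exact chain_sub_aux a η d hs w z h h _ _ hc (by omega)

theorem good_sub (a : Letter g) (η : Letter g → Word g) (d : Letter g → ℤ) (hs : Sub a η d)
    (w : Word g) (hw : Good a w) : Good a (applySub η w) := by
  unfold Good at *
  rw [← applySub_append]
  exact chain_sub a η d hs _ _ _ hw

/-! ### Cancellations -/

theorem reduceOnce_some (w w' : Word g) (h : reduceOnce w = some w') :
    ∃ u b v, w = u ++ b :: invL b :: v ∧ w' = u ++ v := by
  induction w generalizing w' with
  | nil => simp [reduceOnce] at h
  | cons x t ih =>
    cases t with
    | nil => simp [reduceOnce] at h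
    | cons y t =>
      rw [reduceOnce] at h
      split_ifs at h with hy
      · refine ⟨[], x, t, by simp [hy], by simpa using h.symm⟩
      · rw [Option.map_eq_some_iff] at h
        obtain ⟨w₁, h1, h2⟩ := h
        obtain ⟨u, b, v, h3, h4⟩ := ih w₁ h1
        exact ⟨x :: u, b, v, by simp [h3], by simp [← h2, h4]⟩

theorem cycOnce_some (w w' : Word g) (h : cycOnce w = some w') :
    (∃ u b v, w = u ++ b :: invL b :: v ∧ w' = u ++ v) ∨
    (∃ b, w = invL b :: w' ++ [b]) := by
  unfold cycOnce at h
  split at h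
  · next w₁ h1 =>
    left
    apply reduceOnce_some
    rw [h1, h]
  · right
    cases w with
    | nil => simp at h
    | cons x t =>
      rcases List.eq_nil_or_concat t with rfl | ⟨t', b, rfl⟩
      · simp at h
      · simp at h
        obtain ⟨h1, h2⟩ := h
        exact ⟨b, by simp [h1, h2]⟩

theorem reduceOnce_none (w : Word g) (h : w.IsChain (fun a b => b ≠ invL a)) :
    reduceOnce w = none := by
  induction w with
  | nil => rfl
  | cons x t ih =>
    cases t with
    | nil => rfl
    | cons y t =>
      rw [List.isChain_cons_cons] at h
      rw [reduceOnce, if_neg h.1, ih h.2]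
      rfl

theorem cycOnce_none (w : Word g) (h : IsCyclicallyReduced w) : cycOnce w = none := by
  unfold cycOnce
  rw [reduceOnce_none w h.1]
  cases w with
  | nil => rfl
  | cons x t =>
    rcases List.eq_nil_or_concat t with rfl | ⟨t', b, rfl⟩
    · simp
    · have := h.2 x (by simp) b (by simp [List.getLast?_cons])
      simp [this]

theorem cycOnce_length (w w' : Word g) (h : cycOnce w = some w') : w'.length < w.length := by
  rcases cycOnce_some w w' h with ⟨u, b, v, rfl, rfl⟩ | ⟨b, rfl⟩ <;> simp

theorem aux_none (n : ℕ) (w : Word g) (h : w.length ≤ n) :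
    cycOnce (cyclicReduceAux n w) = none := by
  induction n generalizing w with
  | zero =>
    have : w = [] := List.length_eq_zero_iff.1 (by omega)
    subst this
    rfl
  | succ n ih =>
    rw [cyclicReduceAux]
    split
    · assumption
    · next w' hw =>
      have := cycOnce_length w w' hw
      exact ih w' (by omega)

theorem cyclicReduce_of_none (w : Word g) (h : cycOnce w = none) : cyclicReduce w = w := by
  unfold cyclicReduce
  cases w.length with
  | zero => rfl
  | succ n => rw [cyclicReduceAux, h]

theorem cyclicReduce_idem (w : Word g) : cyclicReduce (cyclicReduce w) = cyclicReduce w :=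
  cyclicReduce_of_none _ (aux_none _ _ le_rfl)

theorem not_chain_pair (a b : Letter g) (hb : b.1 ≠ a.1) (h : ℤ) (u v : Word g) :
    ¬ (ht a h (u ++ b :: invL b :: v)).IsChain nc := by
  intro hc
  rw [ht_append] at hc
  have hc := hc.right_of_append
  simp only [ht, if_neg hb, if_neg (show (invL b).1 ≠ a.1 from hb)] at hc
  rw [List.isChain_cons_cons] at hc
  exact hc.1 ⟨rfl, rfl⟩

theorem ht_pair (a b : Letter g) (hb : b.1 = a.1) (h : ℤ) (u v : Word g) :
    ht a h (u ++ b :: invL b :: v) = ht a h (u ++ v) := by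
  rw [ht_append, ht_append]
  simp only [ht, if_pos hb, if_pos (show (invL b).1 = a.1 from hb)]
  rw [sg_invL]
  congr 2
  ring

theorem step (a : Letter g) (w w' : Word g) (hw : Good a w) (h : cycOnce w = some w') :
    Good a w' ∧ na a w' = na a w ∧ es a w' = es a w := by
  rcases cycOnce_some w w' h with ⟨u, b, v, rfl, rfl⟩ | ⟨b, rfl⟩
  · by_cases hb : b.1 = a.1
    · refine ⟨?_, ?_, ?_⟩
      · unfold Good at *
        rw [List.append_assoc, List.cons_append, List.cons_append, ht_pair a b hb,
          ← List.append_assoc, ← List.append_assoc, ht_pair a b hb] at hw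
        simpa using hw
      · unfold na
        rw [ht_pair a b hb]
      · simp only [es_append, es_cons, sg_invL]
        ring
    · exfalso
      unfold Good at hw
      rw [List.append_assoc, List.cons_append, List.cons_append] at hw
      exact not_chain_pair a b hb _ _ _ hw
  · have e : (invL b :: w' ++ [b]) ++ (invL b :: w' ++ [b]) =
        (invL b :: w') ++ b :: invL b :: (w' ++ [b]) := by simp
    by_cases hb : b.1 = a.1
    · refine ⟨?_, ?_, ?_⟩
      · unfold Good at *
        rw [e, ht_pair a b hb] at hw
        simp only [List.cons_append, ht, if_pos (show (invL b).1 = a.1 from hb)] at hw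
        rw [← List.append_assoc, ht_append] at hw
        exact chain_shift a _ _ _ hw.left_of_append
      · have h1 : na a [b] = 0 := by simp [na, ht, hb]
        have h2 : na a [invL b] = 0 := by simp [na, ht, hb, invL_fst]
        have : invL b :: w' ++ [b] = [invL b] ++ w' ++ [b] := rfl
        rw [this, na_append, na_append, h1, h2]
        simp
      · simp only [es_append, es_cons, sg_invL, es_nil, List.cons_append]
        ring
    · exfalso
      unfold Good at hw
      rw [e] at hw
      exact not_chain_pair a b hb _ _ _ hw

theorem aux_inv (a : Letter g) (n : ℕ) (w : Word g) (hw : Good a w) :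
    na a (cyclicReduceAux n w) = na a w ∧ es a (cyclicReduceAux n w) = es a w := by
  induction n generalizing w with
  | zero => exact ⟨rfl, rfl⟩
  | succ n ih =>
    rw [cyclicReduceAux]
    split
    · exact ⟨rfl, rfl⟩
    · next w' h =>
      obtain ⟨h1, h2, h3⟩ := step a w w' hw h
      obtain ⟨h4, h5⟩ := ih w' h1
      exact ⟨h4.trans h2, h5.trans h3⟩

/-! ### Balance -/

theorem sum_odd (f : Letter g → ℤ) (hf : ∀ i, f (i, false) = - f (i, true)) (w : Word g) :
    (w.map f).sum =
      ∑ i : Fin g, ((w.count (i, true) : ℤ) - (w.count (i, false) : ℤ)) * f (i, true) := by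
  induction w with
  | nil => simp
  | cons z w ih =>
    rw [List.map_cons, List.sum_cons, ih]
    have : f z = ∑ i : Fin g, (if i = z.1 then f z else 0) := by simp
    rw [this, ← Finset.sum_add_distrib]
    refine Finset.sum_congr rfl fun i _ => ?_
    obtain ⟨j, b⟩ := z
    rw [List.count_cons, List.count_cons]
    by_cases hij : i = j
    · subst hij
      cases b <;> simp [hf] <;> ring
    · have : ¬ j = i := fun h => hij h.symm
      simp [hij, this]

theorem countS_flatten (S : List (Word g)) (l : Letter g) : countS S l = S.flatten.count l := by
  simp [countS, List.count_flatten]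

theorem sum_bal (f : Letter g → ℤ) (hf : ∀ i, f (i, false) = - f (i, true)) (S : List (Word g))
    (hS : IsBalanced S) : (S.map (fun w => (w.map f).sum)).sum = 0 := by
  have h1 : (S.map (fun w => (w.map f).sum)).sum = (S.flatten.map f).sum := by
    clear hS
    induction S with
    | nil => rfl
    | cons w S ih => simp [ih]
  rw [h1, sum_odd f hf]
  refine Finset.sum_eq_zero fun i _ => ?_
  rw [← countS_flatten, ← countS_flatten, hS i]
  simp

theorem es_sub (a : Letter g) (η : Letter g → Word g) (w : Word g) :
    es a (applySub η w) = (w.map (fun l => es a (η l))).sum := by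
  induction w with
  | nil => rfl
  | cons z w ih => rw [applySub_cons, es_append, ih]; simp

theorem es_sub_odd (a : Letter g) (η : Letter g → Word g) (d : Letter g → ℤ) (hs : Sub a η d)
    (l : Letter g) : es a (η (invL l)) = - es a (η l) := by
  by_cases hl : l.1 = a.1
  · rw [hs.1 l hl, hs.1 (invL l) hl]
    simp [es_cons, es_nil, sg_invL]
  · obtain ⟨P, Q, _, _, e, eP, eQ⟩ := hs.2 l hl
    obtain ⟨P', Q', _, _, e', eP', eQ'⟩ := hs.2 (invL l) hl
    rw [e, e']
    simp only [es_append, es_cons, eP, eQ, eP', eQ', sg_invL, sg_of_ne a l hl, invL_invL]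
    ring

theorem word_identity (a : Letter g) (η : Letter g → Word g) (d : Letter g → ℤ) (hs : Sub a η d)
    (w : Word g) (hw : IsCyclicallyReduced w) :
    (algLen (cyclicReduce (applySub η w)) : ℤ) - algLen w =
      2 * (((cyclicReduce (applySub η w)).count a : ℤ) - (w.count a : ℤ)) -
      (w.map (fun l => es a (η l))).sum + (w.map (sg a)).sum := by
  unfold algLen
  rw [cyclicReduce_idem, cyclicReduce_of_none w (cycOnce_none w hw), length_eq a, length_eq a w]
  obtain ⟨h1, h2⟩ := aux_inv a (applySub η w).length _ (good_sub a η d hs w (good_of_cyc a w hw))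
  have h1 : na a (cyclicReduce (applySub η w)) = _ := h1
  have h2 : es a (cyclicReduce (applySub η w)) = _ := h2
  rw [h1, h2, na_sub a η d hs, es_sub]
  unfold es
  ring

theorem list_identity (a : Letter g) (η : Letter g → Word g) (d : Letter g → ℤ) (hs : Sub a η d)
    (S : List (Word g)) (hS : ∀ w ∈ S, IsCyclicallyReduced w) :
    (algLenS ((S.map (applySub η)).map cyclicReduce) : ℤ) - (algLenS S : ℤ) =
      2 * ((countS ((S.map (applySub η)).map cyclicReduce) a : ℤ) - (countS S a : ℤ)) -
      (S.map (fun w => (w.map (fun l => es a (η l))).sum)).sum +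
      (S.map (fun w => (w.map (sg a)).sum)).sum := by
  induction S with
  | nil => simp [algLenS, countS]
  | cons w S ih =>
    have h1 := ih (fun v hv => hS v (by simp [hv]))
    have h2 := word_identity a η d hs w (hS w (by simp))
    simp only [algLenS, countS, List.map_cons, List.sum_cons] at h1 ⊢
    push_cast at h1 ⊢
    linarith

end WhiteheadAux

/-- Let `S` be a balanced finite list of cyclically reduced words and let `τ` be
a Whitehead substitution of type (2) with multiplier `a`.  Let `S'` be obtained
by applying `τ` to every entry of `S` and then replacing every entry by its
cyclic reduction.  Then the change in algebraic length from `S` to `S'` equals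
twice the change in the total number of occurrences of the letter `a`. -/
theorem length_change_eq_two_mul_multiplier_change {g : ℕ} (hg : 1 ≤ g)
    (S : List (Word g)) (hred : ∀ w ∈ S, IsCyclicallyReduced w)
    (hbal : IsBalanced S) (a : Letter g) (η : Letter g → Word g)
    (hη : IsType2With a η) :
    (algLenS ((S.map (applySub η)).map cyclicReduce) : ℤ) - (algLenS S : ℤ) =
      2 * ((countS ((S.map (applySub η)).map cyclicReduce) a : ℤ) -
        (countS S a : ℤ)) := by
  obtain ⟨d, hs⟩ := WhiteheadAux.exists_sub a η hη
  rw [WhiteheadAux.list_identity a η d hs S hred,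
    WhiteheadAux.sum_bal (fun l => WhiteheadAux.es a (η l))
      (fun i => WhiteheadAux.es_sub_odd a η d hs (i, true)) S hbal,
    WhiteheadAux.sum_bal (WhiteheadAux.sg a)
      (fun i => WhiteheadAux.sg_invL a (i, true)) S hbal]
  ring
end

section
/- Let S be a finite list of words whose cyclic reductions satisfy condition (A), and let τ be a Whitehead substitution. Let S′ be the list obtained by applying τ to every entry of S and then replacing every entry by its cyclic reduction. If the algebraic length of S′ is at most the algebraic length of S, then S′ satisfies condition (A). -/
theorem mk_append' {g : ℕ} (u v : Word g) :
    FreeGroup.mk (u ++ v) = FreeGroup.mk u * FreeGroup.mk v := FreeGroup.mul_mk.symm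

theorem mk_pair {g : ℕ} (a : Letter g) : FreeGroup.mk [a, invL a] = 1 := by
  obtain ⟨i, b⟩ := a
  exact Quot.sound (FreeGroup.Red.Step.not (L₁ := []) (L₂ := []))

theorem mk_pair' {g : ℕ} (a : Letter g) : FreeGroup.mk [invL a, a] = 1 := by
  obtain ⟨i, b⟩ := a
  exact Quot.sound (FreeGroup.Red.Step.not_rev (L₁ := []) (L₂ := []))

theorem invL_invL {g : ℕ} (a : Letter g) : invL (invL a) = a := by
  simp [invL]

theorem ne_invL_iff {g : ℕ} (a b : Letter g) : b ≠ invL a ↔ (a.1 = b.1 → a.2 = b.2) := by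
  obtain ⟨i, x⟩ := a
  obtain ⟨j, y⟩ := b
  cases x <;> cases y <;> simp [invL, eq_comm]

theorem reduceOnce_some {g : ℕ} (w w' : Word g) (h : reduceOnce w = some w') :
    FreeGroup.mk w' = FreeGroup.mk w ∧ w'.length < w.length := by
  induction w generalizing w' with
  | nil => simp [reduceOnce] at h
  | cons a t ih =>
    cases t with
    | nil => simp [reduceOnce] at h
    | cons b rest =>
      rw [reduceOnce] at h
      split_ifs at h with hb
      · simp only [Option.some.injEq] at h
        subst h
        subst hb
        refine ⟨?_, by simp⟩
        have : a :: invL a :: rest = [a, invL a] ++ rest := rfl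
        rw [this, mk_append', mk_pair, one_mul]
      · rw [Option.map_eq_some_iff] at h
        obtain ⟨v, hv, rfl⟩ := h
        obtain ⟨h1, h2⟩ := ih v hv
        refine ⟨?_, by simpa using h2⟩
        have e1 : a :: v = [a] ++ v := rfl
        have e2 : a :: b :: rest = [a] ++ (b :: rest) := rfl
        rw [e1, e2, mk_append', mk_append', h1]

theorem reduceOnce_none {g : ℕ} (w : Word g) (h : reduceOnce w = none) :
    FreeGroup.IsReduced w := by
  induction w with
  | nil => exact FreeGroup.IsReduced.nil
  | cons a t ih =>
    cases t with
    | nil => exact FreeGroup.IsReduced.singleton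
    | cons b rest =>
      rw [reduceOnce] at h
      split_ifs at h with hb
      rw [Option.map_eq_none_iff] at h
      rw [FreeGroup.isReduced_cons_cons]
      exact ⟨(ne_invL_iff a b).1 hb, ih h⟩

theorem cycOnce_some {g : ℕ} (w w' : Word g) (h : cycOnce w = some w') :
    IsConj (FreeGroup.mk w') (FreeGroup.mk w) ∧ w'.length < w.length := by
  unfold cycOnce at h
  split at h
  · rename_i v hv
    simp only [Option.some.injEq] at h
    subst h
    obtain ⟨h1, h2⟩ := reduceOnce_some _ _ hv
    exact ⟨by rw [h1], h2⟩
  · split at h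
    · simp at h
    · rename_i a t _
      split at h
      · simp at h
      · rename_i b hb
        split_ifs at h with hab
        simp only [Option.some.injEq] at h
        subst h
        obtain ⟨s, rfl⟩ := List.getLast?_eq_some_iff.1 hb
        rw [List.dropLast_concat]
        refine ⟨?_, by simp⟩
        rw [isConj_iff]
        refine ⟨FreeGroup.mk [a], ?_⟩
        have hi : (FreeGroup.mk [a])⁻¹ = FreeGroup.mk [b] := by
          rw [inv_eq_iff_mul_eq_one, FreeGroup.mul_mk, hab]
          exact mk_pair' b
        rw [hi, FreeGroup.mul_mk, FreeGroup.mul_mk]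
        simp

theorem cycOnce_none {g : ℕ} (w : Word g) (h : cycOnce w = none) :
    FreeGroup.IsCyclicallyReduced w := by
  unfold cycOnce at h
  split at h
  · simp at h
  · rename_i hr
    refine ⟨reduceOnce_none _ hr, ?_⟩
    cases w with
    | nil => simp
    | cons a t =>
      simp only at h
      split at h
      · rename_i hb
        rw [List.getLast?_eq_none_iff] at hb
        subst hb
        simp
      · rename_i b hb
        split_ifs at h with hab
        obtain ⟨s, rfl⟩ := List.getLast?_eq_some_iff.1 hb
        intro x hx y hy
        have hx' : b = x := by
          have : a :: (s ++ [b]) = (a :: s) ++ [b] := rfl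
          rw [this, List.getLast?_concat] at hx
          simpa using hx
        have hy' : a = y := by simpa using hy
        subst hx'
        subst hy'
        exact (ne_invL_iff b a).1 hab

theorem cyclicReduceAux_spec {g : ℕ} (n : ℕ) (w : Word g) (hn : w.length ≤ n) :
    IsConj (FreeGroup.mk (cyclicReduceAux n w)) (FreeGroup.mk w) ∧
      FreeGroup.IsCyclicallyReduced (cyclicReduceAux n w) := by
  induction n generalizing w with
  | zero =>
    have : w = [] := by simpa using hn
    subst this
    exact ⟨IsConj.refl _, by simp [cyclicReduceAux]⟩
  | succ n ih =>
    rw [cyclicReduceAux]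
    split
    · rename_i h
      exact ⟨IsConj.refl _, cycOnce_none _ h⟩
    · rename_i v h
      obtain ⟨h1, h2⟩ := cycOnce_some _ _ h
      obtain ⟨h3, h4⟩ := ih v (by omega)
      exact ⟨h3.trans h1, h4⟩

theorem cR_conj {g : ℕ} (w : Word g) :
    IsConj (FreeGroup.mk (cyclicReduce w)) (FreeGroup.mk w) :=
  (cyclicReduceAux_spec _ w le_rfl).1

theorem cR_cr {g : ℕ} (w : Word g) : FreeGroup.IsCyclicallyReduced (cyclicReduce w) :=
  (cyclicReduceAux_spec _ w le_rfl).2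

theorem mk_rep {g : ℕ} (v : Word g) (n : ℕ) :
    FreeGroup.mk (List.replicate n v).flatten = FreeGroup.mk v ^ n := by
  induction n with
  | zero => rfl
  | succ n ih => rw [List.replicate_succ, List.flatten_cons, mk_append', ih, pow_succ']

theorem count_rep {g : ℕ} (v : Word g) (n : ℕ) (x : Letter g) :
    (List.replicate n v).flatten.count x = n * v.count x := by
  induction n with
  | zero => simp
  | succ n ih => rw [List.replicate_succ, List.flatten_cons, List.count_append, ih]; ring

theorem count_le_of_conj {g : ℕ} (u v : Word g) (hv : FreeGroup.IsCyclicallyReduced v)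
    (h : IsConj (FreeGroup.mk u) (FreeGroup.mk v)) (x : Letter g) :
    v.count x ≤ u.count x := by
  rw [isConj_iff] at h
  obtain ⟨c, hc⟩ := h
  by_contra! hlt
  set p := c.toWord
  set q := (c⁻¹).toWord
  have key : ∀ n : ℕ, n * v.count x ≤ p.count x + n * u.count x + q.count x := by
    intro n
    have hred := (hv.flatten_replicate n).1
    have heq : FreeGroup.mk (p ++ (List.replicate n u).flatten ++ q) =
        FreeGroup.mk (List.replicate n v).flatten := by
      rw [mk_append', mk_append', mk_rep, mk_rep, FreeGroup.mk_toWord, FreeGroup.mk_toWord,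
        ← hc, conj_pow]
    have hr := FreeGroup.reduce.sound heq
    rw [hred.reduce_eq] at hr
    have hs := (FreeGroup.reduce.red (L := p ++ (List.replicate n u).flatten ++ q)).sublist
    rw [hr] at hs
    have := hs.count_le x
    rw [List.count_append, List.count_append, count_rep, count_rep] at this
    exact this
  have := key (p.count x + q.count x + 1)
  nlinarith

/-- The endomorphism of the free group induced by a substitution. -/
def subHom {g : ℕ} (η : Letter g → Word g) : FreeGroup (Fin g) →* FreeGroup (Fin g) :=
  FreeGroup.lift (fun i => FreeGroup.mk (η (i, true)))

theorem subHom_mk {g : ℕ} (η : Letter g → Word g)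
    (h : ∀ i, FreeGroup.mk (η (i, false)) = (FreeGroup.mk (η (i, true)))⁻¹) (w : Word g) :
    subHom η (FreeGroup.mk w) = FreeGroup.mk (applySub η w) := by
  rw [subHom, FreeGroup.lift_mk]
  induction w with
  | nil => rfl
  | cons a t ih =>
    have : applySub η (a :: t) = η a ++ applySub η t := by simp [applySub]
    rw [List.map_cons, List.prod_cons, ih, this, mk_append']
    congr 1
    obtain ⟨i, b⟩ := a
    cases b <;> simp [h]

theorem mk_wordInv {g : ℕ} (w : Word g) : FreeGroup.mk (wordInv w) = (FreeGroup.mk w)⁻¹ :=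
  FreeGroup.inv_mk.symm

theorem type1_inv {g : ℕ} (η : Letter g → Word g) (h : IsType1 η) (i : Fin g) :
    η (i, false) = wordInv (η (i, true)) := by
  obtain ⟨π, h1, h2⟩ := h
  rw [h2, h2]
  have := h1 (i, true)
  simpa [wordInv, invL] using this

theorem type2_inv {g : ℕ} (a : Letter g) (η : Letter g → Word g) (h : IsType2With a η)
    (i : Fin g) : η (i, false) = wordInv (η (i, true)) := by
  obtain ⟨h1, h2, h3⟩ := h
  by_cases hi : i = a.1
  · subst hi
    obtain ⟨j, b⟩ := a
    cases b <;> simp_all [wordInv, invL]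
  · exact (h3 i hi).2

theorem wh_inv {g : ℕ} (η : Letter g → Word g) (h : IsWhitehead η) (i : Fin g) :
    η (i, false) = wordInv (η (i, true)) := by
  rcases h with h | ⟨a, h⟩
  · exact type1_inv η h i
  · exact type2_inv a η h i

theorem sub_conj {g : ℕ} (η : Letter g → Word g)
    (h : ∀ i, η (i, false) = wordInv (η (i, true))) (w : Word g) :
    IsConj (FreeGroup.mk (applySub η (cyclicReduce w)))
      (FreeGroup.mk (cyclicReduce (applySub η w))) := by
  have h' : ∀ i, FreeGroup.mk (η (i, false)) = (FreeGroup.mk (η (i, true)))⁻¹ := by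
    intro i; rw [h, mk_wordInv]
  refine IsConj.trans ?_ (cR_conj _).symm
  rw [← subHom_mk η h', ← subHom_mk η h']
  exact (subHom η).map_isConj (cR_conj w)

theorem count_sub_le {g : ℕ} (η : Letter g → Word g)
    (h : ∀ i, η (i, false) = wordInv (η (i, true))) (w : Word g) (x : Letter g) :
    (cyclicReduce (applySub η w)).count x ≤ (applySub η (cyclicReduce w)).count x :=
  count_le_of_conj _ _ (cR_cr _) (sub_conj η h w) x

theorem applySub_cons {g : ℕ} (η : Letter g → Word g) (a : Letter g) (t : Word g) :
    applySub η (a :: t) = η a ++ applySub η t := by simp [applySub]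

theorem type2_count_letter {g : ℕ} (a : Letter g) (η : Letter g → Word g)
    (h : IsType2With a η) (x : Letter g) (hx : x.1 ≠ a.1) (y : Letter g) :
    (η y).count x = [y].count x := by
  have hxa : a ≠ x := fun e => hx (by rw [e])
  have hxb : invL a ≠ x := fun e => hx (by rw [← e]; rfl)
  have hinv := type2_inv a η h
  obtain ⟨h1, h2, h3⟩ := h
  by_cases hy : y.1 = a.1
  · have : y = a ∨ y = invL a := by
      obtain ⟨i, b⟩ := y
      obtain ⟨j, c⟩ := a
      simp only at hy
      subst hy
      cases b <;> cases c <;> simp [invL]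
    rcases this with rfl | rfl
    · rw [h1]
    · rw [h2]
  · obtain ⟨i, b⟩ := y
    have h4 := (h3 i hy).1
    cases b
    · rw [hinv]
      rcases h4 with h4 | h4 | h4 | h4 <;> rw [h4] <;>
        simp [wordInv, List.count_cons, hxa, hxb, invL_invL] <;> rfl
    · rcases h4 with h4 | h4 | h4 | h4 <;> rw [h4] <;>
        simp [List.count_cons, hxa, hxb]

theorem type2_count {g : ℕ} (a : Letter g) (η : Letter g → Word g)
    (h : IsType2With a η) (x : Letter g) (hx : x.1 ≠ a.1) (w : Word g) :
    (applySub η w).count x = w.count x := by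
  induction w with
  | nil => rfl
  | cons y t ih =>
    have : y :: t = [y] ++ t := rfl
    rw [applySub_cons, List.count_append, ih, type2_count_letter a η h x hx, ← List.count_append]
    rfl

theorem type2_exists_inv {g : ℕ} (a : Letter g) (η : Letter g → Word g)
    (h : IsType2With a η) : ∃ η', IsType2With (invL a) η' ∧
      ∀ z, subHom η' (subHom η z) = z := by
  classical
  let τ : Fin g → Word g := fun i =>
    if i = a.1 then [(i, true)] else
    if η (i, true) = [(i, true)] then [(i, true)] else
    if η (i, true) = [(i, true), a] then [(i, true), invL a] else
    if η (i, true) = [invL a, (i, true)] then [a, (i, true)] else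
    [a, (i, true), invL a]
  let η' : Letter g → Word g := fun l => if l.2 then τ l.1 else wordInv (τ l.1)
  have ha : η' a = [a] := by
    obtain ⟨j, b⟩ := a
    cases b <;> simp [η', τ, wordInv, invL]
  have ha' : η' (invL a) = [invL a] := by
    obtain ⟨j, b⟩ := a
    cases b <;> simp [η', τ, wordInv, invL]
  have ht : IsType2With (invL a) η' := by
    refine ⟨ha', by rw [invL_invL]; exact ha, ?_⟩
    intro i hi
    have hi' : i ≠ a.1 := hi
    refine ⟨?_, by simp [η']⟩
    rw [invL_invL]
    simp only [η', τ, if_true, if_neg hi']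
    split_ifs <;> simp
  refine ⟨η', ht, ?_⟩
  have hmk : ∀ i, FreeGroup.mk (η' (i, false)) = (FreeGroup.mk (η' (i, true)))⁻¹ := by
    intro i; rw [type2_inv _ _ ht, mk_wordInv]
  have hcomp : (subHom η').comp (subHom η) = MonoidHom.id _ := by
    apply FreeGroup.ext_hom
    intro i
    have e1 : subHom η (FreeGroup.of i) = FreeGroup.mk (η (i, true)) := by simp [subHom]
    rw [MonoidHom.comp_apply, e1, subHom_mk η' hmk, MonoidHom.id_apply]
    have pa : ∀ u v : Word g, FreeGroup.mk (u ++ [a, invL a] ++ v) = FreeGroup.mk (u ++ v) := by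
      intro u v; rw [mk_append', mk_append', mk_pair, mul_one, mk_append']
    have pb : ∀ u v : Word g, FreeGroup.mk (u ++ [invL a, a] ++ v) = FreeGroup.mk (u ++ v) := by
      intro u v; rw [mk_append', mk_append', mk_pair', mul_one, mk_append']
    by_cases hi : i = a.1
    · subst hi
      have e2 : η (a.1, true) = [(a.1, true)] := by
        obtain ⟨h1, h2, -⟩ := h
        obtain ⟨j, b⟩ := a
        cases b
        · exact h2
        · exact h1
      rw [e2, applySub_cons]
      simp [η', τ, applySub, FreeGroup.of]
    · have e3 : η' (i, true) = τ i := by simp [η']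
      rcases (h.2.2 i hi).1 with h4 | h4 | h4 | h4
      · have : τ i = [(i, true)] := by simp [τ, hi, h4]
        rw [h4]; simp only [applySub_cons, e3, this]
        rfl
      · have : τ i = [(i, true), invL a] := by simp [τ, hi, h4]
        rw [h4]; simp only [applySub_cons, e3, this, ha]
        exact pb [(i, true)] []
      · have : τ i = [a, (i, true)] := by
          have hne : invL a ≠ (i, true) := fun e => hi (by rw [← show (invL a).1 = i by rw [e]]; rfl)
          simp [τ, hi, h4, hne]
        rw [h4]; simp only [applySub_cons, e3, this, ha']
        exact pb [] [(i, true)]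
      · have : τ i = [a, (i, true), invL a] := by simp [τ, hi, h4]
        rw [h4]; simp only [applySub_cons, e3, this, ha, ha']
        exact (pb [] ((i, true) :: [invL a, a])).trans (pb [(i, true)] [])
  intro z
  exact DFunLike.congr_fun hcomp z

theorem type2_count_cR {g : ℕ} (a : Letter g) (η : Letter g → Word g)
    (h : IsType2With a η) (x : Letter g) (hx : x.1 ≠ a.1) (w : Word g) :
    (cyclicReduce (applySub η w)).count x = (cyclicReduce w).count x := by
  apply le_antisymm
  · rw [← type2_count a η h x hx (cyclicReduce w)]
    exact count_sub_le η (type2_inv a η h) w x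
  · obtain ⟨η', h', hc⟩ := type2_exists_inv a η h
    have hm : ∀ i, FreeGroup.mk (η (i, false)) = (FreeGroup.mk (η (i, true)))⁻¹ := by
      intro i; rw [type2_inv _ _ h, mk_wordInv]
    have hm' : ∀ i, FreeGroup.mk (η' (i, false)) = (FreeGroup.mk (η' (i, true)))⁻¹ := by
      intro i; rw [type2_inv _ _ h', mk_wordInv]
    rw [← type2_count (invL a) η' h' x hx (cyclicReduce (applySub η w))]
    apply count_le_of_conj _ _ (cR_cr w)
    refine IsConj.trans ?_ (cR_conj w).symm
    rw [← hc (FreeGroup.mk w), ← subHom_mk η' hm', subHom_mk η hm]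
    exact (subHom η').map_isConj (cR_conj _)

/-- Exponent sum of the `i`-th generator. -/
def expo {g : ℕ} (i : Fin g) (w : Word g) : ℤ := (w.count (i, true) : ℤ) - w.count (i, false)

theorem expo_append {g : ℕ} (i : Fin g) (u v : Word g) :
    expo i (u ++ v) = expo i u + expo i v := by
  simp only [expo, List.count_append]; push_cast; ring

theorem expo_conj {g : ℕ} (i : Fin g) (u v : Word g)
    (h : IsConj (FreeGroup.mk u) (FreeGroup.mk v)) : expo i u = expo i v := by
  let f : FreeGroup (Fin g) →* Multiplicative ℤ :=
    FreeGroup.lift (fun j => Multiplicative.ofAdd (if j = i then 1 else 0))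
  have hf : ∀ w : Word g, f (FreeGroup.mk w) = Multiplicative.ofAdd (expo i w) := by
    intro w
    simp only [f, FreeGroup.lift_mk]
    induction w with
    | nil => rfl
    | cons y t ih =>
      have : y :: t = [y] ++ t := rfl
      rw [List.map_cons, List.prod_cons, ih, this, expo_append, ofAdd_add]
      congr 1
      obtain ⟨j, b⟩ := y
      by_cases hj : j = i <;> cases b <;> simp [expo, hj, List.count_cons]
  have := f.map_isConj h
  rw [isConj_iff_eq, hf, hf] at this
  exact Multiplicative.ofAdd.injective this

theorem expo_wordInv {g : ℕ} (i : Fin g) (u : Word g) : expo i (wordInv u) = - expo i u := by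
  induction u with
  | nil => simp [expo, wordInv]
  | cons y t ih =>
    have e : wordInv (y :: t) = wordInv t ++ [invL y] := by simp [wordInv]
    have e' : y :: t = [y] ++ t := rfl
    rw [e, e', expo_append, expo_append, ih]
    have : expo i [invL y] = - expo i [y] := by
      obtain ⟨j, b⟩ := y
      by_cases hj : j = i <;> cases b <;> simp [expo, hj, invL, List.count_cons]
    rw [this]; ring

theorem expo_sub {g : ℕ} (η : Letter g → Word g)
    (h : ∀ i, η (i, false) = wordInv (η (i, true))) (i : Fin g) (w : Word g) :
    expo i (applySub η w) = ∑ j, expo j w * expo i (η (j, true)) := by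
  induction w with
  | nil => simp [applySub, expo]
  | cons y t ih =>
    have e' : y :: t = [y] ++ t := rfl
    rw [applySub_cons, expo_append, ih, e']
    simp only [expo_append, add_mul, Finset.sum_add_distrib]
    congr 1
    obtain ⟨k, b⟩ := y
    rw [Finset.sum_eq_single k]
    · cases b
      · rw [h, expo_wordInv]; simp [expo]
      · simp [expo]
    · intro j _ hj
      simp [expo, List.count_cons, Ne.symm hj]
    · simp

theorem countS_cons {g : ℕ} (w : Word g) (S : List (Word g)) (x : Letter g) :
    countS (w :: S) x = w.count x + countS S x := by simp [countS]

theorem expoS {g : ℕ} (η : Letter g → Word g)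
    (h : ∀ i, η (i, false) = wordInv (η (i, true))) (i : Fin g) (S : List (Word g)) :
    (countS ((S.map (applySub η)).map cyclicReduce) (i, true) : ℤ) -
      countS ((S.map (applySub η)).map cyclicReduce) (i, false) =
    ∑ j, ((countS (S.map cyclicReduce) (j, true) : ℤ) - countS (S.map cyclicReduce) (j, false)) *
      expo i (η (j, true)) := by
  induction S with
  | nil => simp [countS]
  | cons w S ih =>
    have h1 := expo_conj i _ _ (sub_conj η h w)
    rw [expo_sub η h] at h1
    simp only [List.map_cons, countS_cons]
    push_cast
    have h2 : ∀ j, ((cyclicReduce w).count (j, true) : ℤ) + countS (S.map cyclicReduce) (j, true) -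
        ((cyclicReduce w).count (j, false) + countS (S.map cyclicReduce) (j, false)) =
        expo j (cyclicReduce w) +
        ((countS (S.map cyclicReduce) (j, true) : ℤ) - countS (S.map cyclicReduce) (j, false)) := by
      intro j; rw [expo]; ring
    simp only [h2, add_mul, Finset.sum_add_distrib]
    rw [h1, ← ih, expo]; ring

theorem length_eq_sum_count {g : ℕ} (w : Word g) : w.length = ∑ x, w.count x := by
  induction w with
  | nil => simp
  | cons y t ih =>
    simp [List.count_cons, Finset.sum_add_distrib, ih]

theorem sum_length {g : ℕ} (S : List (Word g)) :
    (S.map List.length).sum = ∑ x, countS S x := by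
  induction S with
  | nil => simp [countS]
  | cons w S ih =>
    simp only [List.map_cons, List.sum_cons, countS_cons, Finset.sum_add_distrib, ih,
      ← length_eq_sum_count]

theorem length_cR_cR {g : ℕ} (w : Word g) :
    (cyclicReduce (cyclicReduce w)).length = (cyclicReduce w).length := by
  rw [length_eq_sum_count, length_eq_sum_count]
  refine Finset.sum_congr rfl fun x _ => le_antisymm ?_ ?_
  · exact count_le_of_conj _ _ (cR_cr _) (cR_conj _).symm x
  · exact count_le_of_conj _ _ (cR_cr _) (cR_conj _) x

theorem countS_map_le {g : ℕ} (S : List (Word g)) (f k : Word g → Word g) (x y : Letter g)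
    (h : ∀ w, (f w).count x ≤ (k w).count y) : countS (S.map f) x ≤ countS (S.map k) y := by
  induction S with
  | nil => simp [countS]
  | cons w S ih => simp only [List.map_cons, countS_cons]; exact add_le_add (h w) ih

/-- Let `S` be a finite list of words whose cyclic reductions satisfy condition
(A), and let `τ` be a Whitehead substitution.  Let `S'` be obtained by applying
`τ` to every entry of `S` and then replacing every entry by its cyclic
reduction.  If the algebraic length of `S'` is at most the algebraic length of
`S`, then `S'` satisfies condition (A). -/
theorem condA_whitehead_of_length_le {g : ℕ} (hg : 1 ≤ g) (S : List (Word g))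
    (hA : CondA (S.map cyclicReduce)) (η : Letter g → Word g)
    (hη : IsWhitehead η)
    (hlen : algLenS ((S.map (applySub η)).map cyclicReduce) ≤ algLenS S) :
    CondA ((S.map (applySub η)).map cyclicReduce) := by
  have hinv := wh_inv η hη
  set T := S.map cyclicReduce with hT
  set S' := (S.map (applySub η)).map cyclicReduce with hS'
  have hTle : ∀ x, countS T x ≤ 1 := by
    rintro ⟨i, b⟩
    rcases hA i with ⟨h1, h2⟩ | ⟨h1, h2⟩ <;> cases b <;> omega
  have hbal : ∀ i, countS S' (i, true) = countS S' (i, false) := by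
    intro i
    have h1 := expoS η hinv i S
    rw [Finset.sum_eq_zero] at h1
    · rw [← hS'] at h1; omega
    · intro j _
      rw [← hT]
      rcases hA j with ⟨h2, h3⟩ | ⟨h2, h3⟩ <;> simp [h2, h3]
  have hS'2 : S' = S.map (fun w => cyclicReduce (applySub η w)) := by
    rw [hS', List.map_map]; rfl
  suffices hle : ∀ i, countS S' (i, true) ≤ 1 by
    intro i
    have h1 := hle i
    have h2 := hbal i
    omega
  rcases hη with ⟨π, hπ1, hπ2⟩ | ⟨a, ha⟩
  · intro i
    refine le_trans ?_ (hTle (π.symm (i, true)))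
    rw [hS'2, hT]
    apply countS_map_le
    intro w
    refine (count_sub_le η hinv w _).trans (le_of_eq ?_)
    generalize cyclicReduce w = v
    have : applySub η v = v.map π := by
      induction v with
      | nil => rfl
      | cons y t ih => rw [applySub_cons, ih, hπ2]; rfl
    rw [this]
    conv_lhs => rw [← π.apply_symm_apply (i, true)]
    exact List.count_map_of_injective _ _ π.injective _
  · have heq : ∀ x : Letter g, x.1 ≠ a.1 → countS S' x = countS T x := by
      intro x hx
      rw [hS'2, hT]
      apply le_antisymm <;> apply countS_map_le <;> intro w
      · exact (type2_count_cR a η ha x hx w).le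
      · exact (type2_count_cR a η ha x hx w).ge
    intro i
    by_cases hi : i = a.1
    · have hl1 : algLenS S' = ∑ x, countS S' x := by
        rw [← sum_length, algLenS, hS', List.map_map, List.map_map (g := List.length)]
        congr 1
        apply List.map_congr_left
        intro w _
        exact length_cR_cR w
      have hl2 : algLenS S = ∑ x, countS T x := by
        rw [← sum_length, algLenS, hT, List.map_map]
        rfl
      rw [hl1, hl2, Fintype.sum_prod_type, Fintype.sum_prod_type,
        ← Finset.add_sum_erase _ (fun j => ∑ b, countS S' (j, b)) (Finset.mem_univ i),
        ← Finset.add_sum_erase _ (fun j => ∑ b, countS T (j, b)) (Finset.mem_univ i)] at hlen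
      have hrest : ∑ j ∈ Finset.univ.erase i, ∑ b, countS S' (j, b) =
          ∑ j ∈ Finset.univ.erase i, ∑ b, countS T (j, b) := by
        refine Finset.sum_congr rfl fun j hj => Finset.sum_congr rfl fun b _ => heq (j, b) ?_
        rw [← hi]
        exact Finset.ne_of_mem_erase hj
      rw [hrest] at hlen
      simp only [Fintype.sum_bool] at hlen
      have h1 := hTle (i, true)
      have h2 := hTle (i, false)
      have h3 := hbal i
      omega
    · rw [heq (i, true) hi]
      exact hTle _
end
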